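/- arXiv:1512.01612 — 4 statements merged into one kernel-verified Lean document; each statement's English description precedes it below -/
import Mathlib

section
/- Let n ≥ 1 and Y ∈ 𝕎^n, and define u⁰_Y(X;t) = Σ_{σ ∈ S_n} Λ_Y(X;t;σ) for X ∈ ℤ^n and t ≥ 0. Then u⁰_Y(Y;0) = W(Y), and u⁰_Y(X;0) = 0 for every X ∈ 𝕎^n with X ≠ Y. -/
/-- Extended product `∏'_{k=m}^{n} f k`. -/
noncomputable def eprod (f : ℤ → ℂ) (m n : ℤ) : ℂ :=
  if m ≤ n + 1 then ∏ k ∈ Finset.Icc m n, f k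
  else ∏ k ∈ Finset.Icc (n + 1) (m - 1), (f k)⁻¹

/-- `A_σ(w_1,…,w_n)`: product of `S_{(β,α)}` over inversions `(β,α)` of `σ`. -/
noncomputable def Acoef (q : ℝ) {n : ℕ} (σ : Equiv.Perm (Fin n)) (w : Fin n → ℂ) : ℂ :=
  ∏ p ∈ Finset.univ.filter
      (fun p : Fin n × Fin n => p.2 < p.1 ∧ σ⁻¹ p.1 < σ⁻¹ p.2),
    (-((q : ℂ) * w p.1 - w p.2) / ((q : ℂ) * w p.2 - w p.1))

/-- `B(w_1,…,w_n) = ∏_{i<j} (w_i - w_j)/(w_i - q w_j)`. -/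
noncomputable def Bcoef (q : ℝ) {n : ℕ} (w : Fin n → ℂ) : ℂ :=
  ∏ p ∈ Finset.univ.filter (fun p : Fin n × Fin n => p.1 < p.2),
    (w p.1 - w p.2) / (w p.1 - (q : ℂ) * w p.2)

/-- Iterated contour integral over `n` counterclockwise circles of radius `R` centred at `0`,
outermost variable first. -/
noncomputable def mcInt : (n : ℕ) → ℝ → ((Fin n → ℂ) → ℂ) → ℂ
  | 0, _, f => f (fun i => i.elim0)
  | n + 1, R, f => ∮ z in C(0, R), mcInt n R (fun w => f (Fin.cons z w))

/-- `Λ_Y(X;t;σ)`, with all contours the counterclockwise circle of radius `R`. -/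
noncomputable def Lam (q : ℝ) (b : ℤ → ℝ) {n : ℕ} (Y X : Fin n → ℤ)
    (t : ℝ) (σ : Equiv.Perm (Fin n)) (R : ℝ) : ℂ :=
  (∏ k, (-1 : ℂ) / (b (X k) : ℂ)) * (1 / (2 * Real.pi * Complex.I)) ^ n *
    mcInt n R (fun w =>
      Acoef q σ w *
        ∏ j, (eprod (fun k => (b k : ℂ) / ((b k : ℂ) - w (σ j))) (Y (σ j)) (X j) *
          Complex.exp (-(w j) * (t : ℂ))))

/-- `R` is a valid contour radius for `Λ_Y(X;·;·)`: `R > b k` for every integer `k` in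
`[min_j min(x_j, y_j) - 1, max_j max(x_j, y_j)]`. -/
def ValidR (b : ℤ → ℝ) {n : ℕ} (X Y : Fin n → ℤ) (R : ℝ) : Prop :=
  ∀ k : ℤ, (∃ j, min (X j) (Y j) - 1 ≤ k) → (∃ j, k ≤ max (X j) (Y j)) → b k < R

/-- Number of coordinates of `X` equal to `s`. -/
def cnt {n : ℕ} (X : Fin n → ℤ) (s : ℤ) : ℕ :=
  (Finset.univ.filter (fun j => X j = s)).card

/-- The `q`-deformed factorial `[k]_q! = ∏_{j=1}^{k} (1-q^j)/(1-q)`. -/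
noncomputable def qfac (q : ℝ) (k : ℕ) : ℝ :=
  ∏ j ∈ Finset.Icc 1 k, (1 - q ^ j) / (1 - q)

/-- `W(X) = ∏_i [k_i]_q!` over the distinct values of `X` with multiplicities `k_i`. -/
noncomputable def Wcoef (q : ℝ) {n : ℕ} (X : Fin n → ℤ) : ℝ :=
  ∏ s ∈ Finset.univ.image X, qfac q (cnt X s)

/-- For `X` weakly decreasing, `lowerLast X s = X^{K,-}` where the coordinate lowered by `1`
is the last one equal to `s`. -/
def lowerLast {n : ℕ} (X : Fin n → ℤ) (s : ℤ) : Fin n → ℤ :=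
  fun j => if X j = s ∧ ∀ i, j < i → X i ≠ s then X j - 1 else X j

/-- The `q`-TAZRP master equation for a family `P(X;·)`, `X ∈ 𝕎^n`. -/
def MasterEq (q : ℝ) (a : ℤ → ℝ) {n : ℕ} (P : (Fin n → ℤ) → ℝ → ℂ) : Prop :=
  ∀ X : Fin n → ℤ, Antitone X → ∀ t : ℝ, 0 ≤ t →
    HasDerivAt (P X)
      ((∑ s ∈ Finset.univ.image X,
          (1 - (q : ℂ) ^ cnt (lowerLast X s) (s - 1)) * (a (s - 1) : ℂ) * P (lowerLast X s) t) -
        ∑ s ∈ Finset.univ.image X,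
          (1 - (q : ℂ) ^ cnt X s) * (a s : ℂ) * P X t) t

/-- The tuple `X` with coordinates `k` and `k+1` (0-based) replaced by `u` and `v`. -/
def set2 {n : ℕ} (X : Fin n → ℤ) (k : ℕ) (h : k + 1 < n) (u v : ℤ) : Fin n → ℤ :=
  Function.update (Function.update X ⟨k, by omega⟩ u) ⟨k + 1, h⟩ v

/-- The free particle evolution equation. -/
def FreeEvol (b : ℤ → ℝ) {n : ℕ} (u : (Fin n → ℤ) → ℝ → ℂ) : Prop :=
  ∀ X : Fin n → ℤ, ∀ t : ℝ, 0 ≤ t →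
    HasDerivAt (u X)
      (∑ k, ((b (X k - 1) : ℂ) * u (Function.update X k (X k - 1)) t -
        (b (X k) : ℂ) * u X t)) t

/-- The boundary conditions. -/
def BoundaryCond (q : ℝ) (b : ℤ → ℝ) {n : ℕ} (u : (Fin n → ℤ) → ℝ → ℂ) : Prop :=
  ∀ (k : ℕ) (h : k + 1 < n) (X : Fin n → ℤ) (x : ℤ) (t : ℝ), 0 ≤ t →
    (b (x - 1) : ℂ) * u (set2 X k h (x - 1) x) t =
      (q : ℂ) * (b (x - 1) : ℂ) * u (set2 X k h x (x - 1)) t +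
        (1 - (q : ℂ)) * (b x : ℂ) * u (set2 X k h x x) t

/-- The explicit one-particle transition probability. -/
noncomputable def P1 (b : ℤ → ℝ) (y x : ℤ) (t : ℝ) : ℝ :=
  if x < y then 0
  else if x = y then Real.exp (-(b y) * t)
  else (∏ k ∈ Finset.Icc y (x - 1), b k) *
    ∑ k ∈ Finset.Icc y x,
      (∏ j ∈ (Finset.Icc y x).erase k, (b j - b k)⁻¹) * Real.exp (-(b k) * t)

/-- The torus `|w_i| = R`. -/
def torusSet (n : ℕ) (R : ℝ) : Set (Fin n → ℂ) := {w | ∀ i, ‖w i‖ = R}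

theorem torusMap_mem_torusSet {n : ℕ} {R : ℝ} (hR : 0 ≤ R) (θ : Fin n → ℝ) :
    torusMap 0 (fun _ => R) θ ∈ torusSet n R := by
  intro i
  simp [torusMap, Complex.norm_exp, abs_of_nonneg hR]

theorem torusIntegrable_of_continuousOn {n : ℕ} {R : ℝ} (hR : 0 ≤ R) {f : (Fin n → ℂ) → ℂ}
    (hf : ContinuousOn f (torusSet n R)) : TorusIntegrable f 0 (fun _ => R) := by
  refine ContinuousOn.integrableOn_compact isCompact_Icc (Continuous.continuousOn ?_)
  refine hf.comp_continuous ?_ (torusMap_mem_torusSet hR)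
  unfold torusMap
  fun_prop

theorem insertNth_mem_torusSet {n : ℕ} {R : ℝ} (i : Fin (n + 1)) {z : ℂ} {w : Fin n → ℂ}
    (hz : ‖z‖ = R) (hw : w ∈ torusSet n R) : i.insertNth z w ∈ torusSet (n + 1) R := by
  intro j
  induction j using i.succAboveCases with
  | x => simpa using hz
  | p j => simpa using hw j

theorem mcInt_eq_torusIntegral {R : ℝ} (hR : 0 ≤ R) {n : ℕ} {f : (Fin n → ℂ) → ℂ}
    (hf : ContinuousOn f (torusSet n R)) : mcInt n R f = ∯ w in T(0, fun _ => R), f w := by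
  induction n with
  | zero =>
    rw [torusIntegral_dim0]
    exact congrArg f (Subsingleton.elim _ _)
  | succ n ih =>
    rw [torusIntegral_succ (torusIntegrable_of_continuousOn hR hf)]
    refine circleIntegral.integral_congr hR fun z hz => ?_
    refine ih (hf.comp (by fun_prop) fun w hw => ?_)
    have := insertNth_mem_torusSet 0 (mem_sphere_zero_iff_norm.1 hz) hw
    rwa [Fin.insertNth_zero'] at this

open MeasureTheory Set in
/-- Integration over a torus with the `i`-th variable innermost. -/
theorem torusIntegral_eq_torusIntegral_circleIntegral {n : ℕ} {f : (Fin (n + 1) → ℂ) → ℂ}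
    {c : Fin (n + 1) → ℂ} {R : Fin (n + 1) → ℝ} (hf : TorusIntegrable f c R) (i : Fin (n + 1)) :
    (∯ x in T(c, R), f x) =
      ∯ y in T(c ∘ i.succAbove, R ∘ i.succAbove), ∮ x in C(c i, R i), f (i.insertNth x y) := by
  set e : ℝ × (Fin n → ℝ) ≃ᵐ (Fin (n + 1) → ℝ) :=
    (MeasurableEquiv.piFinSuccAbove (fun _ => ℝ) i).symm
  have hem : MeasurePreserving e :=
    (volume_preserving_piFinSuccAbove (fun _ : Fin (n + 1) => ℝ) i).symm _
  have heπ : (e ⁻¹' Icc 0 fun _ => 2 * Real.pi) =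
      Icc 0 (2 * Real.pi) ×ˢ Icc (0 : Fin n → ℝ) fun _ => 2 * Real.pi :=
    ((Fin.insertNthOrderIso (fun _ => ℝ) i).preimage_Icc _ _).trans (Icc_prod_eq _ _)
  have hint := hf.function_integrable
  rw [← hem.integrableOn_comp_preimage e.measurableEmbedding, heπ, Measure.volume_eq_prod,
    IntegrableOn, ← Measure.prod_restrict] at hint
  rw [torusIntegral, ← hem.map_eq, setIntegral_map_equiv, heπ, Measure.volume_eq_prod,
    ← Measure.prod_restrict]
  refine (integral_prod_symm _ hint).trans ?_
  refine setIntegral_congr_fun measurableSet_Icc fun Θ _ => ?_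
  beta_reduce
  rw [circleIntegral_def_Icc, smul_eq_mul, ← integral_const_mul]
  refine setIntegral_congr_fun measurableSet_Icc fun θ _ => ?_
  have h1 : torusMap c R (e (θ, Θ)) =
      i.insertNth (circleMap (c i) (R i) θ)
        (torusMap (c ∘ i.succAbove) (R ∘ i.succAbove) Θ) := by
    funext j
    induction j using i.succAboveCases with
    | x => simp [e, torusMap, circleMap, MeasurableEquiv.piFinSuccAbove_symm_apply]
    | p j => simp [e, torusMap, MeasurableEquiv.piFinSuccAbove_symm_apply]
  rw [Function.comp_apply]
  rw [h1]
  simp [e, deriv_circleMap, i.prod_univ_succAbove _, circleMap,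
    MeasurableEquiv.piFinSuccAbove_symm_apply]
  ring

/-- Two iterated integrals agree as soon as the integrals over one of the variables do. -/
theorem mcInt_congr_update {R : ℝ} (hR : 0 ≤ R) {n : ℕ} {f g : (Fin n → ℂ) → ℂ}
    (hf : ContinuousOn f (torusSet n R)) (hg : ContinuousOn g (torusSet n R)) (i : Fin n)
    (h : ∀ w ∈ torusSet n R,
      (∮ z in C(0, R), f (Function.update w i z)) = ∮ z in C(0, R), g (Function.update w i z)) :
    mcInt n R f = mcInt n R g := by
  obtain _ | n := n
  · exact i.elim0
  rw [mcInt_eq_torusIntegral hR hf, mcInt_eq_torusIntegral hR hg,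
    torusIntegral_eq_torusIntegral_circleIntegral (torusIntegrable_of_continuousOn hR hf) i,
    torusIntegral_eq_torusIntegral_circleIntegral (torusIntegrable_of_continuousOn hR hg) i]
  unfold torusIntegral
  congr 1 with θ
  congr 1
  have hR' : ‖(R : ℂ)‖ = R := by simp [abs_of_nonneg hR]
  have := h _ (insertNth_mem_torusSet i hR' (torusMap_mem_torusSet hR θ))
  simp only [Fin.update_insertNth] at this
  exact this

theorem mcInt_const_mul {n : ℕ} (R : ℝ) (c : ℂ) (f : (Fin n → ℂ) → ℂ) :
    mcInt n R (fun w => c * f w) = c * mcInt n R f := by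
  induction n with
  | zero => rfl
  | succ n ih => simp only [mcInt, ih, circleIntegral.integral_const_mul]

theorem mcInt_prod {n : ℕ} (R : ℝ) (h : Fin n → ℂ → ℂ) :
    mcInt n R (fun w => ∏ i, h i (w i)) = ∏ i, ∮ z in C(0, R), h i z := by
  induction n with
  | zero => simp [mcInt]
  | succ n ih =>
    simp only [mcInt, Fin.prod_univ_succ, Fin.cons_zero, Fin.cons_succ, mcInt_const_mul, ih]
    simp only [mul_comm _ (∏ _, _), circleIntegral.integral_const_mul]

open Filter Topology Bornology in
/-- The residue at infinity. -/
theorem circleIntegral_of_tendsto_cobounded {R : ℝ} (hR : 0 < R) {g : ℂ → ℂ} {L : ℂ}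
    (hd : ∀ z, R ≤ ‖z‖ → DifferentiableAt ℂ g z)
    (hL : Tendsto (fun z => z * g z) (cobounded ℂ) (𝓝 L)) :
    (∮ z in C(0, R), g z) = 2 * Real.pi * Complex.I * L := by
  have hconst : ∀ r : ℝ, R ≤ r →
      (∮ z in C(0, r), g z) = ∮ z in C(0, R), g z := fun r hr => by
    refine Complex.circleIntegral_eq_of_differentiable_on_annulus_off_countable hR hr
      Set.countable_empty (fun z hz => (hd z ?_).continuousAt.continuousWithinAt)
      fun z hz => hd z ?_
    · simpa using hz.2
    · have := hz.1.2
      simp only [mem_closedBall_zero_iff, not_le] at this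
      exact this.le
  rw [← sub_eq_zero, ← norm_eq_zero]
  refine le_antisymm (le_of_forall_pos_le_add fun ε hε => ?_) (norm_nonneg _)
  have hε' : 0 < ε / (2 * Real.pi) := by positivity
  have hev := (Metric.tendsto_nhds.1 hL) _ hε'
  rw [← comap_norm_atTop, eventually_comap] at hev
  obtain ⟨r, hr, hrR⟩ := (hev.and (eventually_ge_atTop R)).exists
  have hr0 : 0 < r := hR.trans_le hrR
  have hne : ∀ z ∈ Metric.sphere (0 : ℂ) r, z ≠ 0 := fun z hz h0 => by
    simp [h0] at hz; exact hr0.ne' hz.symm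
  have hLint : (∮ z in C(0, r), L * z⁻¹) = 2 * Real.pi * Complex.I * L := by
    have := circleIntegral.integral_sub_center_inv (0 : ℂ) hr0.ne'
    simp only [sub_zero] at this
    rw [circleIntegral.integral_const_mul, this, mul_comm]
  have hgi : CircleIntegrable g 0 r :=
    ContinuousOn.circleIntegrable hr0.le fun z hz =>
      (hd z (by simpa [mem_sphere_zero_iff_norm.1 hz] using hrR)).continuousAt.continuousWithinAt
  have hii : CircleIntegrable (fun z => L * z⁻¹) 0 r :=
    ContinuousOn.circleIntegrable hr0.le
      (continuousOn_const.mul (continuousOn_id.inv₀ hne))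
  rw [← hconst r hrR, ← hLint, ← circleIntegral.integral_sub hgi hii, zero_add]
  refine (circleIntegral.norm_integral_le_of_norm_le_const (C := ε / (2 * Real.pi) / r)
    hr0.le fun z hz => ?_).trans (le_of_eq (by field_simp))
  have hz' := mem_sphere_zero_iff_norm.1 hz
  have h1 := (hr z hz').le
  have h2 : g z - L * z⁻¹ = (z * g z - L) / z := by
    have := hne z hz
    field_simp
  rw [h2, norm_div, hz', ← dist_eq_norm]
  gcongr

/-- The inversions of `σ`, as pairs of values `(β, α)` with `α < β`. -/
def inversions {n : ℕ} (σ : Equiv.Perm (Fin n)) : Finset (Fin n × Fin n) :=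
  Finset.univ.filter (fun p : Fin n × Fin n => p.2 < p.1 ∧ σ⁻¹ p.1 < σ⁻¹ p.2)

theorem card_inversions {n : ℕ} (σ : Equiv.Perm (Fin n)) :
    (inversions σ).card = ∑ i, ∑ j, if i < j ∧ σ j < σ i then 1 else 0 := by
  rw [← Fintype.sum_prod_type', Finset.sum_boole, Nat.cast_id]
  refine Finset.card_bij' (fun p _ => (σ⁻¹ p.1, σ⁻¹ p.2)) (fun p _ => (σ p.1, σ p.2)) ?_ ?_ ?_ ?_
  · simp +contextual [inversions]
  · simp +contextual [inversions]
  · simp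
  · simp

/-- The permutation sending `0` to `p` and `i.succ` to `p.succAbove (τ i)`. -/
def insertPerm {n : ℕ} (p : Fin (n + 1)) (τ : Equiv.Perm (Fin n)) : Equiv.Perm (Fin (n + 1)) :=
  (Equiv.Perm.decomposeFin.symm (0, τ)).trans p.cycleRange.symm

@[simp]
theorem insertPerm_zero {n : ℕ} (p : Fin (n + 1)) (τ : Equiv.Perm (Fin n)) :
    insertPerm p τ 0 = p := by
  simp [insertPerm]

@[simp]
theorem insertPerm_succ {n : ℕ} (p : Fin (n + 1)) (τ : Equiv.Perm (Fin n)) (i : Fin n) :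
    insertPerm p τ i.succ = p.succAbove (τ i) := by
  simp [insertPerm]

theorem bijective_insertPerm (n : ℕ) :
    Function.Bijective fun x : Fin (n + 1) × Equiv.Perm (Fin n) => insertPerm x.1 x.2 := by
  rw [Fintype.bijective_iff_injective_and_card]
  refine ⟨?_, by simp [Fintype.card_perm, Nat.factorial_succ]⟩
  rintro ⟨p, τ⟩ ⟨p', τ'⟩ h
  dsimp only at h
  obtain rfl : p = p' := by simpa using DFunLike.congr_fun h 0
  refine Prod.ext rfl (Equiv.ext fun i => ?_)
  simpa using DFunLike.congr_fun h i.succ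

theorem card_inversions_insertPerm {n : ℕ} (p : Fin (n + 1)) (τ : Equiv.Perm (Fin n)) :
    (inversions (insertPerm p τ)).card = p + (inversions τ).card := by
  simp only [card_inversions, Fin.sum_univ_succ (n := n), insertPerm_zero, insertPerm_succ,
    Fin.succ_lt_succ_iff, p.strictMono_succAbove.lt_iff_lt, Fin.succ_pos,
    Fin.not_lt_zero, false_and, true_and, if_false, zero_add, Fin.succAbove_lt_iff_castSucc_lt]
  congr 1
  rw [Equiv.sum_comp τ (fun j => if j.castSucc < p then 1 else 0), Finset.sum_boole, Nat.cast_id]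
  have h : (Finset.univ.filter fun j : Fin n => j.castSucc < p).map Fin.castSuccEmb =
      Finset.Iio p := by
    ext x
    simp only [Finset.mem_map, Finset.mem_filter, Finset.mem_univ, true_and, Finset.mem_Iio]
    constructor
    · rintro ⟨j, hj, rfl⟩
      exact hj
    · intro hx
      exact ⟨x.castPred (ne_of_lt (hx.trans_le (Fin.le_last p))), by simpa using hx, by simp⟩
  rw [← Finset.card_map, h, Fin.card_Iio]

theorem comp_insertPerm_eq_iff {n : ℕ} {Y : Fin (n + 1) → ℤ} (hY : Antitone Y)
    (p : Fin (n + 1)) (τ : Equiv.Perm (Fin n)) :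
    Y ∘ insertPerm p τ = Y ↔
      Y p = Y 0 ∧ (Y ∘ Fin.succ) ∘ τ = Y ∘ Fin.succ := by
  have key : Y p = Y 0 → Y ∘ p.succAbove = Y ∘ Fin.succ := fun hp => by
    funext j
    rcases lt_or_ge j.castSucc p with h | h
    · have hle : ∀ i ≤ p, Y i = Y 0 := fun i hi =>
        le_antisymm (hY (Fin.zero_le i)) (hp ▸ hY hi)
      simp only [Function.comp_apply, Fin.succAbove_of_castSucc_lt _ _ h]
      rw [hle _ h.le, hle _ (Fin.castSucc_lt_iff_succ_le.1 h)]
    · simp [Fin.succAbove_of_le_castSucc _ _ h]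
  have key' : Y p = Y 0 → ∀ j, Y (p.succAbove j) = Y j.succ := fun hp j => congrFun (key hp) j
  simp only [funext_iff, Fin.forall_fin_succ (n := n), Function.comp_apply, insertPerm_zero,
    insertPerm_succ]
  refine and_congr_right fun hp => ?_
  simp only [key' hp]

theorem cnt_succ_comp {n : ℕ} (Y : Fin (n + 1) → ℤ) (s : ℤ) :
    cnt Y s = (if Y 0 = s then 1 else 0) + cnt (Y ∘ Fin.succ) s := by
  simp only [cnt, Finset.card_filter, Fin.sum_univ_succ, Function.comp_apply]

theorem apply_eq_apply_zero_iff_lt_cnt {n : ℕ} {Y : Fin (n + 1) → ℤ} (hY : Antitone Y)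
    (p : Fin (n + 1)) : Y p = Y 0 ↔ (p : ℕ) < cnt Y (Y 0) := by
  constructor
  · intro hp
    have : Finset.Iic p ⊆ Finset.univ.filter (fun j => Y j = Y 0) := fun i hi => by
      simp only [Finset.mem_filter, Finset.mem_univ, true_and]
      exact le_antisymm (hY (Fin.zero_le i)) (hp ▸ hY (Finset.mem_Iic.1 hi))
    have := Finset.card_le_card this
    rw [Fin.card_Iic] at this
    exact this
  · intro h
    by_contra hp
    have : Finset.univ.filter (fun j => Y j = Y 0) ⊆ Finset.Iio p := fun i hi => by
      simp only [Finset.mem_filter, Finset.mem_univ, true_and] at hi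
      rw [Finset.mem_Iio]
      by_contra hip
      exact hp (le_antisymm (hY (Fin.zero_le p)) (hi ▸ hY (not_lt.1 hip)))
    have := Finset.card_le_card this
    rw [Fin.card_Iio] at this
    exact absurd h (not_lt.2 this)

theorem qfac_succ (q : ℝ) (k : ℕ) : qfac q (k + 1) = qfac q k * ((1 - q ^ (k + 1)) / (1 - q)) := by
  rw [qfac, Finset.prod_Icc_succ_top (by omega)]
  rfl

theorem Wcoef_succ (q : ℝ) {n : ℕ} (Y : Fin (n + 1) → ℤ) :
    Wcoef q Y = (1 - q ^ cnt Y (Y 0)) / (1 - q) * Wcoef q (Y ∘ Fin.succ) := by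
  have hsub : Finset.univ.image (Y ∘ Fin.succ) ⊆ Finset.univ.image Y := by
    intro s
    simp only [Finset.mem_image, Finset.mem_univ, true_and]
    rintro ⟨j, rfl⟩
    exact ⟨_, rfl⟩
  have h0 : Y 0 ∈ Finset.univ.image Y := Finset.mem_image_of_mem _ (Finset.mem_univ _)
  have hW : Wcoef q (Y ∘ Fin.succ) =
      ∏ s ∈ Finset.univ.image Y, qfac q (cnt (Y ∘ Fin.succ) s) := by
    refine Finset.prod_subset hsub fun s _ hs => ?_
    have : cnt (Y ∘ Fin.succ) s = 0 := by
      rw [cnt, Finset.card_eq_zero, Finset.filter_eq_empty_iff]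
      rintro j - rfl
      exact hs (Finset.mem_image_of_mem _ (Finset.mem_univ _))
    simp [this, qfac]
  rw [hW, Wcoef, ← Finset.mul_prod_erase _ _ h0, ← Finset.mul_prod_erase _ _ h0, ← mul_assoc]
  congr 1
  · rw [cnt_succ_comp Y, if_pos rfl, add_comm, qfac_succ, mul_comm]
  · refine Finset.prod_congr rfl fun s hs => ?_
    rw [cnt_succ_comp Y, if_neg (Finset.ne_of_mem_erase hs).symm, zero_add]

/-- The inversion generating function of the stabilizer of a weakly decreasing tuple. -/
theorem sum_pow_card_inversions {q : ℝ} (hq : q ≠ 1) {n : ℕ} {Y : Fin n → ℤ} (hY : Antitone Y) :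
    (∑ σ : Equiv.Perm (Fin n), if Y ∘ σ = Y then q ^ (inversions σ).card else 0) =
      Wcoef q Y := by
  induction n with
  | zero => simp [Wcoef, inversions, Subsingleton.elim (_ ∘ _) Y]
  | succ n ih =>
    rw [Wcoef_succ, ← ih (Y := Y ∘ Fin.succ) (hY.comp_monotone Fin.strictMono_succ.monotone),
      ← (bijective_insertPerm n).sum_comp (fun σ =>
         if Y ∘ σ = Y then q ^ (inversions σ).card else 0),
      Fintype.sum_prod_type]
    have hgeom : (1 - q ^ cnt Y (Y 0)) / (1 - q) =
        ∑ p : Fin (n + 1), if Y p = Y 0 then q ^ (p : ℕ) else 0 := by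
      have hle : cnt Y (Y 0) ≤ n + 1 := (Finset.card_le_univ _).trans_eq (by simp)
      simp only [apply_eq_apply_zero_iff_lt_cnt hY]
      rw [Fin.sum_univ_eq_sum_range (fun i => if i < cnt Y (Y 0) then q ^ i else 0),
        ← Finset.sum_filter, ← neg_div_neg_eq, neg_sub, neg_sub, ← geom_sum_eq hq]
      refine Finset.sum_congr ?_ fun _ _ => rfl
      ext i
      simp only [Finset.mem_range, Finset.mem_filter]
      omega
    rw [hgeom, Finset.sum_mul_sum]
    refine Finset.sum_congr rfl fun p _ => Finset.sum_congr rfl fun τ _ => ?_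
    simp only [comp_insertPerm_eq_iff hY, card_inversions_insertPerm, pow_add]
    split_ifs <;> simp_all

/-- The factor `S_{(β,α)}` for `p = (β, α)`. -/
noncomputable def Sfactor (q : ℝ) {n : ℕ} (p : Fin n × Fin n) (w : Fin n → ℂ) : ℂ :=
  -((q : ℂ) * w p.1 - w p.2) / ((q : ℂ) * w p.2 - w p.1)

/-- A product of factors `S_p`, `p ∈ P`, and of one-variable functions. -/
noncomputable def betheIntegrand (q : ℝ) {n : ℕ} (P : Finset (Fin n × Fin n)) (h : Fin n → ℂ → ℂ)
    (w : Fin n → ℂ) : ℂ :=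
  (∏ p ∈ P, Sfactor q p w) * ∏ i, h i (w i)

theorem mul_sub_ne_zero_of_norm_le {q : ℝ} (hq : q ∈ Set.Ioo (0 : ℝ) 1) {u v : ℂ}
    (huv : ‖u‖ ≤ ‖v‖) (hv : 0 < ‖v‖) : (q : ℂ) * u - v ≠ 0 := by
  intro h
  have h1 : ‖(q : ℂ) * u‖ = ‖v‖ := by rw [sub_eq_zero.1 h]
  rw [norm_mul, Complex.norm_real, Real.norm_of_nonneg hq.1.le] at h1
  nlinarith [hq.1, hq.2, norm_nonneg u]

theorem continuousOn_betheIntegrand {q : ℝ} (hq : q ∈ Set.Ioo (0 : ℝ) 1) {R : ℝ} (hR : 0 < R)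
    {n : ℕ} (P : Finset (Fin n × Fin n)) {h : Fin n → ℂ → ℂ}
    (hh : ∀ i, ∀ z, R ≤ ‖z‖ → DifferentiableAt ℂ (h i) z) :
    ContinuousOn (betheIntegrand q P h) (torusSet n R) := by
  refine ContinuousOn.mul (continuousOn_finsetProd _ fun p _ => ?_)
    (continuousOn_finsetProd _ fun i _ => ?_)
  · refine ContinuousOn.div (by fun_prop) (by fun_prop) fun w hw => ?_
    exact mul_sub_ne_zero_of_norm_le hq (by rw [hw, hw]) (by rwa [hw])
  · exact fun w hw => ((hh i (w i) (hw i).ge).continuousAt.comp (f := fun w : Fin n → ℂ => w i)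
      (continuous_apply i).continuousAt).continuousWithinAt

/-- If the `i`-th variable meets no pole inside its contour, the integral vanishes. -/
theorem mcInt_betheIntegrand_eq_zero {q : ℝ} (hq : q ∈ Set.Ioo (0 : ℝ) 1) {R : ℝ} (hR : 0 < R)
    {n : ℕ} {P : Finset (Fin n × Fin n)} {h : Fin n → ℂ → ℂ}
    (hh : ∀ i, ∀ z, R ≤ ‖z‖ → DifferentiableAt ℂ (h i) z) (i : Fin n)
    (hi : Differentiable ℂ (h i)) (hP : ∀ p ∈ P, p.1 ≠ i) :
    mcInt n R (betheIntegrand q P h) = 0 := by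
  have h0 : mcInt n R (fun _ => (0 : ℂ)) = 0 := by
    simpa using mcInt_const_mul R 0 (fun _ : Fin n → ℂ => (0 : ℂ))
  rw [← h0]
  refine mcInt_congr_update hR.le (continuousOn_betheIntegrand hq hR P hh) continuousOn_const i
    fun w hw => ?_
  have hzero : (∮ z in C(0, R), (0 : ℂ)) = 0 := by simp [circleIntegral]
  rw [hzero]
  have hd : ∀ z, ‖z‖ ≤ R →
      DifferentiableAt ℂ (fun z => betheIntegrand q P h (Function.update w i z)) z := by
    intro z hz
    refine DifferentiableAt.mul (DifferentiableAt.fun_finsetProd fun p hp => ?_)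
      (DifferentiableAt.fun_finsetProd fun j _ => ?_)
    · have hp1 := hP p hp
      have hp2 : DifferentiableAt ℂ (fun z => Function.update w i z p.2) z :=
        differentiableAt_pi.1 (hasDerivAt_update w i z).differentiableAt p.2
      have hle : ‖Function.update w i z p.2‖ ≤ R := by
        by_cases h2 : p.2 = i
        · simpa [h2] using hz
        · simpa [h2] using (hw p.2).le
      simp only [Sfactor, Function.update_of_ne hp1]
      refine DifferentiableAt.div (by fun_prop) (by fun_prop) ?_
      exact mul_sub_ne_zero_of_norm_le hq (by rwa [hw]) (by rwa [hw])
    · by_cases hj : j = i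
      · subst hj
        simpa using hi z
      · simp [hj]
  refine Complex.circleIntegral_eq_zero_of_differentiable_on_off_countable hR.le
    Set.countable_empty (fun z hz => (hd z ?_).continuousAt.continuousWithinAt) fun z hz => hd z ?_
  · simpa using hz
  · have := hz.1
    rw [mem_ball_zero_iff] at this
    exact this.le

section InitialCondition

open Filter Topology Bornology

theorem tendsto_div_sub_cobounded (a c : ℂ) :
    Tendsto (fun z => a / (c - z)) (cobounded ℂ) (𝓝 0) := by
  have := (tendsto_inv₀_cobounded.comp (tendsto_const_sub_cobounded c)).const_mul a
  simpa [div_eq_mul_inv] using this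

theorem tendsto_Sfactor_cobounded (q u : ℂ) :
    Tendsto (fun z => -(q * z - u) / (q * u - z)) (cobounded ℂ) (𝓝 q) := by
  have h := (tendsto_div_sub_cobounded (u - q ^ 2 * u) (q * u)).const_add q
  rw [add_zero] at h
  refine h.congr' ?_
  filter_upwards [eventually_ne_cobounded (q * u)] with z hz
  have : q * u - z ≠ 0 := sub_ne_zero.2 hz.symm
  field_simp
  ring

theorem tendsto_mul_div_sub_cobounded (c : ℂ) :
    Tendsto (fun z => z * (c / (c - z))) (cobounded ℂ) (𝓝 (-c)) := by
  have h := (tendsto_div_sub_cobounded (c ^ 2) c).const_add (-c)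
  rw [add_zero] at h
  refine h.congr' ?_
  filter_upwards [eventually_ne_cobounded c] with z hz
  have : c - z ≠ 0 := sub_ne_zero.2 hz.symm
  field_simp
  ring

/-- Integration over the `i`-th variable when it meets no pole outside its contour. -/
theorem circleIntegral_betheIntegrand_update {q : ℝ} (hq : q ∈ Set.Ioo (0 : ℝ) 1) {R : ℝ}
    (hR : 0 < R) {n : ℕ} {P : Finset (Fin n × Fin n)} {h : Fin n → ℂ → ℂ}
    (hh : ∀ i, ∀ z, R ≤ ‖z‖ → DifferentiableAt ℂ (h i) z) {i : Fin n} {L : ℂ}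
    (hL : Tendsto (fun z => z * h i z) (cobounded ℂ) (𝓝 L)) (hP : ∀ p ∈ P, p.2 ≠ i)
    {w : Fin n → ℂ} (hw : w ∈ torusSet n R) :
    (∮ z in C(0, R), betheIntegrand q P h (Function.update w i z)) =
      2 * Real.pi * Complex.I * ((∏ p ∈ P, if p.1 = i then (q : ℂ) else Sfactor q p w) *
        (L * ∏ j ∈ Finset.univ.erase i, h j (w j))) := by
  refine circleIntegral_of_tendsto_cobounded hR (fun z hz => ?_) ?_
  · refine DifferentiableAt.mul (DifferentiableAt.fun_finsetProd fun p hp => ?_)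
      (DifferentiableAt.fun_finsetProd fun j _ => ?_)
    · have hp2 := hP p hp
      have hp1 : DifferentiableAt ℂ (fun z => Function.update w i z p.1) z :=
        differentiableAt_pi.1 (hasDerivAt_update w i z).differentiableAt p.1
      have hle : R ≤ ‖Function.update w i z p.1‖ := by
        by_cases h1 : p.1 = i
        · simpa [h1] using hz
        · simpa [h1] using (hw p.1).ge
      simp only [Sfactor, Function.update_of_ne hp2]
      refine DifferentiableAt.div (by fun_prop) (by fun_prop) ?_
      exact mul_sub_ne_zero_of_norm_le hq (by rwa [hw]) (hR.trans_le hle)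
    · by_cases hj : j = i
      · subst hj
        simpa using hh j z hz
      · simp [hj]
  · have hS : Tendsto (fun z => ∏ p ∈ P, Sfactor q p (Function.update w i z)) (cobounded ℂ)
        (𝓝 (∏ p ∈ P, if p.1 = i then (q : ℂ) else Sfactor q p w)) := by
      refine tendsto_finsetProd _ fun p hp => ?_
      simp only [Sfactor, Function.update_of_ne (hP p hp)]
      split_ifs with h1
      · simpa [h1] using tendsto_Sfactor_cobounded q (w p.2)
      · simp [h1]
    refine (hS.mul (hL.mul_const (∏ j ∈ Finset.univ.erase i, h j (w j)))).congr fun z => ?_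
    have hprod : ∏ j, h j (Function.update w i z j) =
        h i z * ∏ j ∈ Finset.univ.erase i, h j (w j) := by
      rw [← Finset.mul_prod_erase _ _ (Finset.mem_univ i), Function.update_self]
      congr 1
      refine Finset.prod_congr rfl fun j hj => ?_
      rw [Function.update_of_ne (Finset.ne_of_mem_erase hj)]
    rw [betheIntegrand, hprod]
    ring

/-- If the `i`-th variable meets no pole outside its contour and the integrand decays, the
integral vanishes. -/
theorem mcInt_betheIntegrand_eq_zero_of_tendsto {q : ℝ} (hq : q ∈ Set.Ioo (0 : ℝ) 1) {R : ℝ}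
    (hR : 0 < R) {n : ℕ} {P : Finset (Fin n × Fin n)} {h : Fin n → ℂ → ℂ}
    (hh : ∀ i, ∀ z, R ≤ ‖z‖ → DifferentiableAt ℂ (h i) z) (i : Fin n)
    (hL : Tendsto (fun z => z * h i z) (cobounded ℂ) (𝓝 0)) (hP : ∀ p ∈ P, p.2 ≠ i) :
    mcInt n R (betheIntegrand q P h) = 0 := by
  have h0 : mcInt n R (fun _ => (0 : ℂ)) = 0 := by
    simpa using mcInt_const_mul R 0 (fun _ : Fin n → ℂ => (0 : ℂ))
  rw [← h0]
  refine mcInt_congr_update hR.le (continuousOn_betheIntegrand hq hR P hh) continuousOn_const i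
    fun w hw => ?_
  rw [circleIntegral_betheIntegrand_update hq hR hh hL hP hw]
  simp [circleIntegral]

/-- When every one-variable factor has a simple pole at infinity, each `S_p` contributes `q`. -/
theorem mcInt_betheIntegrand_eq {q : ℝ} (hq : q ∈ Set.Ioo (0 : ℝ) 1) {R : ℝ}
    (hR : 0 < R) {n : ℕ} (P : Finset (Fin n × Fin n)) {h : Fin n → ℂ → ℂ}
    (hh : ∀ i, ∀ z, R ≤ ‖z‖ → DifferentiableAt ℂ (h i) z) {L : Fin n → ℂ}
    (hL : ∀ i, Tendsto (fun z => z * h i z) (cobounded ℂ) (𝓝 (L i))) (hP : ∀ p ∈ P, p.2 < p.1) :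
    mcInt n R (betheIntegrand q P h) = q ^ P.card * ∏ i, (2 * Real.pi * Complex.I * L i) := by
  induction P using Finset.induction_on_max_value (fun p : Fin n × Fin n => p.1) with
  | empty =>
    have hempty : betheIntegrand q ∅ h = fun w => ∏ i, h i (w i) := by
      funext w
      simp [betheIntegrand]
    rw [hempty, mcInt_prod, Finset.card_empty, pow_zero, one_mul]
    exact Finset.prod_congr rfl fun i _ => circleIntegral_of_tendsto_cobounded hR (hh i) (hL i)
  | insert p P hp hmax ih =>
    have hP' : ∀ r ∈ P, r.2 < r.1 := fun r hr => hP r (Finset.mem_insert_of_mem hr)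
    have hne : ∀ r ∈ insert p P, r.2 ≠ p.1 := fun r hr => by
      refine ((hP r hr).trans_le ?_).ne
      rcases Finset.mem_insert.1 hr with rfl | hr
      · exact le_rfl
      · exact hmax r hr
    have hstep : mcInt n R (betheIntegrand q (insert p P) h) =
        mcInt n R (fun w => (q : ℂ) * betheIntegrand q P h w) := by
      refine mcInt_congr_update hR.le (continuousOn_betheIntegrand hq hR _ hh)
        (continuousOn_const.mul (continuousOn_betheIntegrand hq hR P hh)) p.1 fun w hw => ?_
      rw [circleIntegral.integral_const_mul,
        circleIntegral_betheIntegrand_update hq hR hh (hL p.1) hne hw,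
        circleIntegral_betheIntegrand_update hq hR hh (hL p.1)
          (fun r hr => hne r (Finset.mem_insert_of_mem hr)) hw,
        Finset.prod_insert hp, if_pos rfl]
      ring
    rw [hstep, mcInt_const_mul, ih hP', Finset.card_insert_of_notMem hp]
    ring

/-- The one-variable factor `∏'_{k=y}^{x} b_k / (b_k - z)`. -/
noncomputable def siteFactor (b : ℤ → ℝ) (y x : ℤ) (z : ℂ) : ℂ :=
  eprod (fun k => (b k : ℂ) / ((b k : ℂ) - z)) y x

theorem differentiable_siteFactor_of_lt (b : ℤ → ℝ) {y x : ℤ} (h : x < y) :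
    Differentiable ℂ (siteFactor b y x) := by
  unfold siteFactor eprod
  split_ifs with h1
  · rw [Finset.Icc_eq_empty (by omega)]
    simp
  · simp only [inv_div]
    fun_prop

theorem differentiableAt_siteFactor {b : ℤ → ℝ} {R : ℝ} {y x : ℤ} (hb0 : ∀ k, 0 < b k)
    (hb : ∀ k, y ≤ k → k ≤ x → b k < R) {z : ℂ} (hz : R ≤ ‖z‖) :
    DifferentiableAt ℂ (siteFactor b y x) z := by
  rcases lt_or_ge x y with h | h
  · exact differentiable_siteFactor_of_lt b h z
  · have hle : y ≤ x + 1 := by omega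
    unfold siteFactor eprod
    simp only [if_pos hle]
    refine DifferentiableAt.fun_finsetProd fun k hk => ?_
    refine DifferentiableAt.div (by fun_prop) (by fun_prop) ?_
    rw [Finset.mem_Icc] at hk
    intro h0
    have h1 : ‖z‖ = b k := by
      rw [← sub_eq_zero.1 h0, Complex.norm_real, Real.norm_of_nonneg (hb0 k).le]
    linarith [hb k hk.1 hk.2]

theorem tendsto_mul_siteFactor_self (b : ℤ → ℝ) (y : ℤ) :
    Tendsto (fun z => z * siteFactor b y y z) (cobounded ℂ) (𝓝 (-(b y : ℂ))) := by
  unfold siteFactor eprod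
  simpa using tendsto_mul_div_sub_cobounded (b y)

theorem tendsto_mul_siteFactor_of_lt (b : ℤ → ℝ) {y x : ℤ} (h : y < x) :
    Tendsto (fun z => z * siteFactor b y x z) (cobounded ℂ) (𝓝 0) := by
  have h1 : Tendsto (fun z => ∏ k ∈ (Finset.Icc y x).erase y, (b k : ℂ) / ((b k : ℂ) - z))
      (cobounded ℂ) (𝓝 (∏ k ∈ (Finset.Icc y x).erase y, 0)) :=
    tendsto_finsetProd _ fun k _ => tendsto_div_sub_cobounded _ _
  have hx : x ∈ (Finset.Icc y x).erase y :=
    Finset.mem_erase.2 ⟨h.ne', Finset.mem_Icc.2 ⟨h.le, le_rfl⟩⟩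
  rw [Finset.prod_eq_zero hx rfl] at h1
  have h2 := (tendsto_mul_div_sub_cobounded (b y)).mul h1
  rw [mul_zero] at h2
  refine h2.congr fun z => ?_
  unfold siteFactor eprod
  rw [if_pos (by omega), ← Finset.mul_prod_erase _ _ (Finset.mem_Icc.2 ⟨le_refl y, h.le⟩)]
  ring

theorem Lam_zero_eq (q : ℝ) (b : ℤ → ℝ) {n : ℕ} (Y X : Fin n → ℤ) (σ : Equiv.Perm (Fin n))
    (R : ℝ) :
    Lam q b Y X 0 σ R = (∏ k, (-1 : ℂ) / (b (X k) : ℂ)) * (1 / (2 * Real.pi * Complex.I)) ^ n *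
      mcInt n R (betheIntegrand q (inversions σ) fun i => siteFactor b (Y i) (X (σ⁻¹ i))) := by
  unfold Lam
  congr 2
  funext w
  simp only [Complex.ofReal_zero, mul_zero, Complex.exp_zero, mul_one, betheIntegrand]
  congr 1
  rw [← Equiv.prod_comp σ (fun i => siteFactor b (Y i) (X (σ⁻¹ i)) (w i))]
  simp [siteFactor]

theorem Lam_zero_eq_ite {q : ℝ} (hq : q ∈ Set.Ioo (0 : ℝ) 1) {b : ℤ → ℝ} (hb : ∀ k, 0 < b k)
    {n : ℕ} {Y X : Fin (n + 1) → ℤ} (hY : Antitone Y) (hX : Antitone X) {R : ℝ}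
    (hR : ValidR b X Y R) (σ : Equiv.Perm (Fin (n + 1))) :
    Lam q b Y X 0 σ R = if X = Y ∘ σ then (q : ℂ) ^ (inversions σ).card else 0 := by
  have hR0 : 0 < R := (hb _).trans (hR (X 0) ⟨0, by omega⟩ ⟨0, le_max_left _ _⟩)
  have hh : ∀ i, ∀ z : ℂ, R ≤ ‖z‖ →
      DifferentiableAt ℂ (siteFactor b (Y i) (X (σ⁻¹ i))) z := fun i z hz => by
    refine differentiableAt_siteFactor hb (fun k h1 h2 => hR k ⟨i, ?_⟩ ⟨σ⁻¹ i, ?_⟩) hz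
    · have := min_le_right (X i) (Y i)
      omega
    · exact h2.trans (le_max_left _ _)
  have hinv : ∀ p ∈ inversions σ, p.2 < p.1 ∧ σ⁻¹ p.1 < σ⁻¹ p.2 := fun p hp => by
    simpa only [inversions, Finset.mem_filter, Finset.mem_univ, true_and] using hp
  rw [Lam_zero_eq]
  by_cases hlt : ∃ i, X (σ⁻¹ i) < Y i
  · obtain ⟨i, hi, hmin⟩ := WellFounded.has_min (wellFounded_lt (α := Fin (n + 1)))
      {i | X (σ⁻¹ i) < Y i} hlt
    rw [mcInt_betheIntegrand_eq_zero hq hR0 hh i (differentiable_siteFactor_of_lt b hi), mul_zero,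
      if_neg]
    · rintro rfl
      simp at hi
    · rintro p hp rfl
      obtain ⟨h1, h2⟩ := hinv p hp
      exact hmin p.2 (((hX h2.le).trans_lt hi).trans_le (hY h1.le)) h1
  by_cases hgt : ∃ i, Y i < X (σ⁻¹ i)
  · obtain ⟨i, hi, hmax⟩ := WellFounded.has_min (wellFounded_gt (α := Fin (n + 1)))
      {i | Y i < X (σ⁻¹ i)} hgt
    rw [mcInt_betheIntegrand_eq_zero_of_tendsto hq hR0 hh i (tendsto_mul_siteFactor_of_lt b hi),
      mul_zero, if_neg]
    · rintro rfl
      simp at hi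
    · rintro p hp rfl
      obtain ⟨h1, h2⟩ := hinv p hp
      exact hmax p.1 (((hY h1.le).trans_lt hi).trans_le (hX h2.le)) h1
  push Not at hlt hgt
  have heq : X = Y ∘ σ := funext fun j => by
    have h1 := hlt (σ j)
    have h2 := hgt (σ j)
    simp only [Equiv.Perm.coe_inv, Equiv.symm_apply_apply] at h1 h2
    exact le_antisymm h2 h1
  have hL : ∀ i, Tendsto (fun z => z * siteFactor b (Y i) (X (σ⁻¹ i)) z) (cobounded ℂ)
      (𝓝 (-(b (Y i) : ℂ))) := fun i => by
    have : X (σ⁻¹ i) = Y i := by simp [heq]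
    rw [this]
    exact tendsto_mul_siteFactor_self b (Y i)
  rw [mcInt_betheIntegrand_eq hq hR0 _ hh hL fun p hp => (hinv p hp).1, if_pos heq]
  have hprod : ∏ k, (-1 : ℂ) / (b (X k) : ℂ) = ∏ i, (-1 : ℂ) / (b (Y i) : ℂ) := by
    rw [heq]
    exact Equiv.prod_comp σ (fun i => (-1 : ℂ) / (b (Y i) : ℂ))
  have hpow : (1 / (2 * Real.pi * Complex.I)) ^ (n + 1) =
      ∏ _i : Fin (n + 1), 1 / (2 * Real.pi * Complex.I) := by simp
  rw [hprod, hpow, mul_left_comm, ← Finset.prod_mul_distrib, ← Finset.prod_mul_distrib,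
    Finset.prod_eq_one, mul_one]
  intro i _
  have hbi : (b (Y i) : ℂ) ≠ 0 := Complex.ofReal_ne_zero.2 (hb _).ne'
  have hpi := Complex.two_pi_I_ne_zero
  field_simp

end InitialCondition

/-- `u⁰_Y(X;t) = Σ_σ Λ_Y(X;t;σ)` satisfies the initial condition
`u⁰_Y(Y;0) = W(Y)` and `u⁰_Y(X;0) = 0` for `X ∈ 𝕎^n`, `X ≠ Y`. -/
theorem bethe_ansatz_initial_condition
    (q : ℝ) (hq : q ∈ Set.Ioo (0 : ℝ) 1) (a b : ℤ → ℝ)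
    (ha : ∀ i, 0 < a i) (hb : ∀ i, b i = a i * (1 - q))
    (n : ℕ) (Y : Fin (n + 1) → ℤ) (hY : Antitone Y) :
    (∀ R : ℝ, ValidR b Y Y R →
      (∑ σ : Equiv.Perm (Fin (n + 1)), Lam q b Y Y 0 σ R) = ((Wcoef q Y : ℝ) : ℂ)) ∧
    ∀ X : Fin (n + 1) → ℤ, Antitone X → X ≠ Y → ∀ R : ℝ, ValidR b X Y R →
      (∑ σ : Equiv.Perm (Fin (n + 1)), Lam q b Y X 0 σ R) = 0 := by
  have hb0 : ∀ k, 0 < b k := fun k => by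
    rw [hb]
    exact mul_pos (ha k) (sub_pos.2 hq.2)
  refine ⟨fun R hR => ?_, fun X hX hXY R hR => Finset.sum_eq_zero fun σ _ => ?_⟩
  · simp only [Lam_zero_eq_ite hq hb0 hY hY hR, eq_comm (a := Y),
      ← sum_pow_card_inversions hq.2.ne hY]
    push_cast
    exact Finset.sum_congr rfl fun σ _ => by split_ifs <;> simp
  · rw [Lam_zero_eq_ite hq hb0 hY hX hR, if_neg]
    rintro rfl
    exact hXY (Tuple.unique_antitone (τ := 1) hX hY)
end

section
/- Let n ≥ 2, k ∈ {1,…,n−1}, and let μ ∈ S_n with α := μ(k) < μ(k+1) =: β, and set ν = μ∘(k, k+1) (the transposition of k and k+1). Then for all complex w_1,…,w_n with q w_α − w_β ≠ 0 and all the denominators appearing in A_μ nonzero: A_ν(w_1,…,w_n) = A_μ(w_1,…,w_n) · S_{(β,α)}, where S_{(β,α)} = −(q w_β − w_α)/(q w_α − w_β). -/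
/-- An adjacent transposition changes the relative order only of the two points it exchanges. -/
theorem swap_lt_swap_iff_of_val_eq_succ {n : ℕ} {a b : Fin n} (hab : (b : ℕ) = a + 1)
    (i j : Fin n) :
    Equiv.swap a b i < Equiv.swap a b j ↔
      (i < j ∧ ¬(i = a ∧ j = b)) ∨ (i = b ∧ j = a) := by
  simp only [Equiv.swap_apply_def, Fin.lt_def, Fin.ext_iff]
  split_ifs <;> omega

/-- Multiplying `μ` on the right by an adjacent transposition at an ascent adds exactly one
inversion. -/
theorem filter_inversions_mul_swap {n : ℕ} {a b : Fin n} (hab : (b : ℕ) = a + 1)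
    (μ : Equiv.Perm (Fin n)) (h : μ a < μ b) :
    Finset.univ.filter (fun p : Fin n × Fin n =>
        p.2 < p.1 ∧ (μ * Equiv.swap a b)⁻¹ p.1 < (μ * Equiv.swap a b)⁻¹ p.2) =
      insert (μ b, μ a) (Finset.univ.filter (fun p : Fin n × Fin n =>
        p.2 < p.1 ∧ μ⁻¹ p.1 < μ⁻¹ p.2)) := by
  ext ⟨x, y⟩
  obtain ⟨i, rfl⟩ := μ.surjective x
  obtain ⟨j, rfl⟩ := μ.surjective y
  simp only [mul_inv_rev, Equiv.swap_inv, Equiv.Perm.mul_apply, Equiv.Perm.coe_inv, Equiv.symm_apply_apply,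
    Finset.mem_filter, Finset.mem_univ, true_and, Finset.mem_insert, Prod.mk.injEq,
    EmbeddingLike.apply_eq_iff_eq, swap_lt_swap_iff_of_val_eq_succ hab]
  constructor
  · tauto
  · rintro (⟨rfl, rfl⟩ | ⟨hlt, hij⟩)
    · exact ⟨h, Or.inr ⟨rfl, rfl⟩⟩
    · refine ⟨hlt, Or.inl ⟨hij, ?_⟩⟩
      rintro ⟨rfl, rfl⟩
      exact lt_asymm h hlt

/-- `A_ν = A_μ ⬝ S_{(β,α)}` for `ν = μ ∘ (k, k+1)` with `α = μ(k) < μ(k+1) = β`. -/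
theorem A_nu_eq_A_mu_mul_S
    (q : ℝ) (hq : q ∈ Set.Ioo (0 : ℝ) 1) (n : ℕ) (k : ℕ) (hk : k + 1 < n + 2)
    (μ ν : Equiv.Perm (Fin (n + 2)))
    (hν : ν = μ * Equiv.swap ⟨k, by omega⟩ ⟨k + 1, hk⟩)
    (hαβ : μ ⟨k, by omega⟩ < μ ⟨k + 1, hk⟩)
    (w : Fin (n + 2) → ℂ)
    (hd : (q : ℂ) * w (μ ⟨k, by omega⟩) - w (μ ⟨k + 1, hk⟩) ≠ 0)
    (hden : ∀ p ∈ Finset.univ.filter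
        (fun p : Fin (n + 2) × Fin (n + 2) => p.2 < p.1 ∧ μ⁻¹ p.1 < μ⁻¹ p.2),
      (q : ℂ) * w p.2 - w p.1 ≠ 0) :
    Acoef q ν w = Acoef q μ w *
      (-((q : ℂ) * w (μ ⟨k + 1, hk⟩) - w (μ ⟨k, by omega⟩)) /
        ((q : ℂ) * w (μ ⟨k, by omega⟩) - w (μ ⟨k + 1, hk⟩))) := by
  subst hν
  rw [Acoef, filter_inversions_mul_swap rfl μ hαβ, Finset.prod_insert, mul_comm, Acoef]
  simp
end

section
/- Let n ≥ 2, k ∈ {1,…,n}, and let σ ∈ S_n with σ(1) = k; let τ = φ_k(σ) ∈ S_{n−1}. Then for all complex w_1,…,w_n such that all denominators involved are nonzero: A_σ(w_1,…,w_n) = ( ∏_{j=1}^{k−1} (q w_k − w_j)/(w_k − q w_j) ) · A_τ(w_1,…,w_{k−1}, w_{k+1},…,w_n), where A_τ is evaluated at the n−1 variables obtained by deleting w_k (the i-th argument of A_τ is w_i for i < k and w_{i+1} for i ≥ k). -/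
/-- A value map that closes the gap at `k` is inverse to `k.succAbove`. -/
theorem eq_succAbove_of_val_eq_ite {n : ℕ} {k a : Fin (n + 1)} {b : Fin n} (hak : a ≠ k)
    (hb : (b : ℕ) = if (a : ℕ) < (k : ℕ) then (a : ℕ) else (a : ℕ) - 1) :
    a = k.succAbove b := by
  have hne : (a : ℕ) ≠ (k : ℕ) := fun h => hak (Fin.ext h)
  rw [Fin.ext_iff, Fin.succAbove]
  split_ifs at hb with h1 <;> split_ifs with h2 <;>
    simp only [Fin.lt_def, Fin.val_castSucc, Fin.val_succ] at * <;> omega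

/-- `Acoef` as an iterated product. -/
theorem Acoef_eq_prod_prod (q : ℝ) {n : ℕ} (σ : Equiv.Perm (Fin n)) (w : Fin n → ℂ) :
    Acoef q σ w = ∏ a, ∏ b, if b < a ∧ σ⁻¹ a < σ⁻¹ b then
      (-((q : ℂ) * w a - w b) / ((q : ℂ) * w b - w a)) else 1 := by
  rw [Acoef, Finset.prod_filter, Fintype.prod_prod_type]

/-- factorization of `A_σ` for `σ(1) = k`, with `τ = φ_k(σ)`. -/
theorem A_sigma_factorization_phi
    (q : ℝ) (hq : q ∈ Set.Ioo (0 : ℝ) 1) (n : ℕ) (k : Fin (n + 2))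
    (σ : Equiv.Perm (Fin (n + 2))) (hσ : σ 0 = k)
    (τ : Equiv.Perm (Fin (n + 1)))
    (hτ : ∀ i : Fin (n + 1), (τ i : ℕ) =
      if (σ i.succ : ℕ) < (k : ℕ) then (σ i.succ : ℕ) else (σ i.succ : ℕ) - 1)
    (w : Fin (n + 2) → ℂ)
    (hden : ∀ i j : Fin (n + 2), i ≠ j → (q : ℂ) * w i - w j ≠ 0) :
    Acoef q σ w =
      (∏ j ∈ Finset.univ.filter (fun j : Fin (n + 2) => j < k),
        ((q : ℂ) * w k - w j) / (w k - (q : ℂ) * w j)) *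
      Acoef q τ (w ∘ k.succAbove) := by
  have hsucc : ∀ i : Fin (n + 1), σ i.succ = k.succAbove (τ i) := fun i =>
    eq_succAbove_of_val_eq_ite
      (fun h => Fin.succ_ne_zero i (σ.injective (h.trans hσ.symm))) (hτ i)
  have hinv0 : σ⁻¹ k = 0 := by rw [Equiv.Perm.inv_eq_iff_eq, hσ]
  have hinv : ∀ j, σ⁻¹ (k.succAbove j) = (τ⁻¹ j).succ := fun j => by
    rw [Equiv.Perm.inv_eq_iff_eq, hsucc, ← Equiv.Perm.mul_apply, mul_inv_cancel,
      Equiv.Perm.one_apply]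
  rw [Acoef_eq_prod_prod, Acoef_eq_prod_prod, Fin.prod_univ_succAbove _ k, Finset.prod_filter]
  congr 1
  · refine Finset.prod_congr rfl fun j _ => ?_
    have hpos : j < k → σ⁻¹ k < σ⁻¹ j := fun hj => by
      rw [hinv0, Fin.pos_iff_ne_zero, Ne, Equiv.Perm.inv_eq_iff_eq, hσ]
      exact hj.ne
    simp only [and_iff_left_of_imp hpos, ← neg_sub (w k), neg_div_neg_eq]
  · refine Finset.prod_congr rfl fun a _ => ?_
    rw [Fin.prod_univ_succAbove _ k]
    simp only [hinv0, hinv, Fin.not_lt_zero, and_false, if_false, one_mul, Fin.succ_lt_succ_iff,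
      Fin.succAbove_lt_succAbove_iff, Function.comp_apply]
end

section
/- Let n ≥ 1, X, Y ∈ 𝕎^n, m ∈ {1,…,n}, and σ ∈ S_n with σ(m) = 1. If x_m < y_1, then Λ_Y(X;0;σ) = 0. -/
theorem cons_circleMap (R θ : ℝ) {n : ℕ} (φ : Fin n → ℝ) :
    (Fin.cons (circleMap 0 R θ) (fun i => circleMap 0 R (φ i)) : Fin (n + 1) → ℂ) =
      fun i => circleMap 0 R ((Fin.cons θ φ : Fin (n + 1) → ℝ) i) := by
  funext i
  refine Fin.cases ?_ (fun i => ?_) i <;> simp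

/-- An iterated contour integral depends continuously on parameters, provided the integrand is
jointly continuous on the torus. -/
theorem continuous_mcInt {R : ℝ} (n : ℕ) :
    ∀ {P : Type} [TopologicalSpace P] [FirstCountableTopology P]
      {G : P → (Fin n → ℂ) → ℂ},
      Continuous (fun p : P × (Fin n → ℝ) => G p.1 (fun i => circleMap 0 R (p.2 i))) →
      Continuous (fun p => mcInt n R (G p)) := by
  induction n with
  | zero =>
    intro P _ _ G hG
    have h := hG.comp (continuous_id.prodMk continuous_const : Continuous
      (fun p : P => (p, (fun i => i.elim0 : Fin 0 → ℝ))))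
    refine h.congr fun p => ?_
    simp only [Function.comp_apply, mcInt, id]
    congr 1
    funext i
    exact i.elim0
  | succ n ih =>
    intro P _ _ G hG
    simp only [mcInt, circleIntegral]
    apply intervalIntegral.continuous_parametric_intervalIntegral_of_continuous'
    simp only [Function.uncurry_def, deriv_circleMap]
    refine Continuous.smul (f := fun p : P × ℝ => circleMap 0 R p.2 * Complex.I)
      (by fun_prop) ?_
    refine ih (P := P × ℝ)
      (G := fun p w => G p.1 (Fin.cons (circleMap 0 R p.2) w)) ?_
    simp only [cons_circleMap]
    exact hG.comp (g := fun p : P × (Fin (n + 1) → ℝ) => G p.1 (fun i => circleMap 0 R (p.2 i)))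
      (f := fun p : (P × ℝ) × (Fin n → ℝ) => (p.1.1, (Fin.cons p.1.2 p.2 : Fin (n + 1) → ℝ)))
      (by fun_prop)

theorem circleIntegral_swap {R : ℝ} {F : ℂ → ℂ → ℂ}
    (hF : Continuous (fun p : ℝ × ℝ => F (circleMap 0 R p.1) (circleMap 0 R p.2))) :
    (∮ z in C(0, R), ∮ u in C(0, R), F z u) = ∮ u in C(0, R), ∮ z in C(0, R), F z u := by
  simp only [circleIntegral, ← intervalIntegral.integral_smul (𝕜 := ℂ) (E := ℂ)]
  rw [MeasureTheory.intervalIntegral_intervalIntegral_swap]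
  · simp only [smul_comm (deriv (circleMap 0 R) _) (deriv (circleMap 0 R) _)]
  · refine (Continuous.continuousOn ?_).integrableOn_compact
      (isCompact_uIcc.prod isCompact_uIcc) |>.mono_set
        (Set.prod_mono Set.uIoc_subset_uIcc Set.uIoc_subset_uIcc)
    simp only [Function.uncurry_def, deriv_circleMap]
    exact Continuous.smul (f := fun p : ℝ × ℝ => circleMap 0 R p.1 * Complex.I) (by fun_prop)
      (Continuous.smul (f := fun p : ℝ × ℝ => circleMap 0 R p.2 * Complex.I) (by fun_prop) hF)

theorem mcInt_congr {R : ℝ} (n : ℕ) : ∀ {f g : (Fin n → ℂ) → ℂ},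
    (∀ θ : Fin n → ℝ, f (fun i => circleMap 0 R (θ i)) = g (fun i => circleMap 0 R (θ i))) →
      mcInt n R f = mcInt n R g := by
  induction n with
  | zero =>
    intro f g h
    have h0 := h (fun i => i.elim0)
    have e : (fun i : Fin 0 => circleMap 0 R (i.elim0 : ℝ)) = fun i => i.elim0 := by
      funext i
      exact i.elim0
    rw [e] at h0
    exact h0
  | succ n ih =>
    intro f g h
    simp only [mcInt, circleIntegral]
    congr 1
    funext θ
    congr 1
    refine ih fun φ => ?_
    simpa only [cons_circleMap] using h (Fin.cons θ φ)

theorem mcInt_zero {R : ℝ} (n : ℕ) : mcInt n R (fun _ => 0) = 0 := by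
  induction n with
  | zero => rfl
  | succ n ih => simp [mcInt, ih, circleIntegral]

/-- The outermost contour integral may be moved inside. -/
theorem circleIntegral_mcInt_swap {R : ℝ} (n : ℕ) : ∀ {G : ℂ → (Fin n → ℂ) → ℂ},
    Continuous (fun p : ℝ × (Fin n → ℝ) =>
      G (circleMap 0 R p.1) (fun i => circleMap 0 R (p.2 i))) →
    (∮ z in C(0, R), mcInt n R (G z)) = mcInt n R (fun w => ∮ z in C(0, R), G z w) := by
  induction n with
  | zero => intro G _; rfl
  | succ n ih =>
    intro G hG
    simp only [mcInt]
    rw [circleIntegral_swap (F := fun z u => mcInt n R (fun w => G z (Fin.cons u w)))]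
    · simp only [circleIntegral]
      congr 1
      funext θ
      congr 1
      refine ih (G := fun z w => G z (Fin.cons (circleMap 0 R θ) w)) ?_
      simp only [cons_circleMap]
      exact hG.comp (g := fun p : ℝ × (Fin (n + 1) → ℝ) =>
          G (circleMap 0 R p.1) (fun i => circleMap 0 R (p.2 i)))
        (f := fun p : ℝ × (Fin n → ℝ) => (p.1, (Fin.cons θ p.2 : Fin (n + 1) → ℝ)))
        (by fun_prop)
    · refine continuous_mcInt n (P := ℝ × ℝ)
        (G := fun p w => G (circleMap 0 R p.1) (Fin.cons (circleMap 0 R p.2) w)) ?_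
      simp only [cons_circleMap]
      exact hG.comp (g := fun p : ℝ × (Fin (n + 1) → ℝ) =>
          G (circleMap 0 R p.1) (fun i => circleMap 0 R (p.2 i)))
        (f := fun p : (ℝ × ℝ) × (Fin n → ℝ) =>
          (p.1.1, (Fin.cons p.1.2 p.2 : Fin (n + 1) → ℝ)))
        (by fun_prop)

/-- An iterated contour integral vanishes when the integrand is holomorphic in the outermost
variable on the closed disc. -/
theorem mcInt_eq_zero_of_differentiableAt {R : ℝ} (hR : 0 ≤ R) {n : ℕ}
    {f : (Fin (n + 1) → ℂ) → ℂ}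
    (hc : Continuous (fun θ : Fin (n + 1) → ℝ => f (fun i => circleMap 0 R (θ i))))
    (hd : ∀ w : Fin n → ℂ, (∀ i, ‖w i‖ = R) → ∀ z : ℂ, ‖z‖ ≤ R →
      DifferentiableAt ℂ (fun z => f (Fin.cons z w)) z) :
    mcInt (n + 1) R f = 0 := by
  simp only [mcInt]
  rw [circleIntegral_mcInt_swap]
  · refine (mcInt_congr n fun θ => ?_).trans (mcInt_zero n)
    have hd' := hd (fun i => circleMap 0 R (θ i)) (fun i => by simp [abs_of_nonneg hR])
    refine Complex.circleIntegral_eq_zero_of_differentiable_on_off_countable hR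
      Set.countable_empty
      (fun z hz => (hd' z (by simpa using hz)).continuousAt.continuousWithinAt)
      fun z hz => hd' z (by simpa using (Metric.ball_subset_closedBall hz.1))
  · simp only [cons_circleMap]
    exact hc.comp (f := fun p : ℝ × (Fin n → ℝ) => (Fin.cons p.1 p.2 : Fin (n + 1) → ℝ))
      (by fun_prop)

theorem q_mul_sub_ne_zero {q R : ℝ} (hq : q ∈ Set.Ioo (0 : ℝ) 1) (hR : 0 < R) {u v : ℂ}
    (hu : ‖u‖ ≤ R) (hv : ‖v‖ = R) : (q : ℂ) * u - v ≠ 0 := by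
  intro h
  have h1 : ‖(q : ℂ) * u‖ = R := by rw [sub_eq_zero.1 h, hv]
  rw [norm_mul, Complex.norm_real, Real.norm_of_nonneg hq.1.le] at h1
  nlinarith [hq.1, hq.2]

theorem continuous_Acoef_torus {q R : ℝ} (hq : q ∈ Set.Ioo (0 : ℝ) 1) (hR : 0 < R) {n : ℕ}
    (σ : Equiv.Perm (Fin n)) :
    Continuous (fun θ : Fin n → ℝ => Acoef q σ (fun i => circleMap 0 R (θ i))) := by
  unfold Acoef
  refine continuous_finsetProd _ fun p _ => Continuous.div (by fun_prop) (by fun_prop) fun θ => ?_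
  exact q_mul_sub_ne_zero hq hR (by simp [abs_of_pos hR]) (by simp [abs_of_pos hR])

theorem differentiableAt_cons {n : ℕ} (w : Fin n → ℂ) (i : Fin (n + 1)) (z : ℂ) :
    DifferentiableAt ℂ (fun z => (Fin.cons z w : Fin (n + 1) → ℂ) i) z := by
  refine Fin.cases ?_ (fun i => ?_) i <;> simp

theorem differentiableAt_Acoef_cons {q R : ℝ} (hq : q ∈ Set.Ioo (0 : ℝ) 1) (hR : 0 < R) {n : ℕ}
    (σ : Equiv.Perm (Fin (n + 1))) {w : Fin n → ℂ} (hw : ∀ i, ‖w i‖ = R) {z : ℂ}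
    (hz : ‖z‖ ≤ R) :
    DifferentiableAt ℂ (fun z => Acoef q σ (Fin.cons z w)) z := by
  unfold Acoef
  refine DifferentiableAt.fun_finsetProd fun p hp => ?_
  have h1 := differentiableAt_cons w p.1 z
  have h2 := differentiableAt_cons w p.2 z
  refine DifferentiableAt.fun_div (by fun_prop) (by fun_prop) ?_
  apply q_mul_sub_ne_zero hq hR
  · refine Fin.cases (by simpa using hz) (fun i => ?_) p.2
    simp [hw]
  · obtain ⟨i, hi⟩ := Fin.exists_succ_eq.2 (Fin.ne_zero_of_lt (Finset.mem_filter.1 hp).2.1)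
    rw [← hi]
    simp [hw]

theorem continuous_eprod_circleMap {b : ℤ → ℝ} {R : ℝ} (hR : 0 < R) {y x : ℤ}
    (hb0 : ∀ k, 0 < b k) (hb : ∀ k, y ≤ k → k ≤ x → b k < R) :
    Continuous (fun θ : ℝ => eprod (fun k => (b k : ℂ) / ((b k : ℂ) - circleMap 0 R θ)) y x) := by
  unfold eprod
  split_ifs
  · refine continuous_finsetProd _ fun k hk =>
      Continuous.div (by fun_prop) (by fun_prop) fun θ h => ?_
    rw [Finset.mem_Icc] at hk
    have h1 := congrArg norm (sub_eq_zero.1 h)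
    rw [Complex.norm_real, Real.norm_of_nonneg (hb0 k).le, norm_circleMap_zero,
      abs_of_pos hR] at h1
    exact (hb k hk.1 hk.2).ne h1
  · simp only [inv_div]
    fun_prop

theorem differentiable_eprod_of_lt (b : ℤ → ℝ) {y x : ℤ} (h : x < y) :
    Differentiable ℂ (fun z : ℂ => eprod (fun k => (b k : ℂ) / ((b k : ℂ) - z)) y x) := by
  unfold eprod
  split_ifs
  · rw [Finset.Icc_eq_empty (by omega)]
    simp
  · simp only [inv_div]
    fun_prop

/-- `Λ_Y(X;0;σ) = 0` when `σ(m) = 1` and `x_m < y_1`. -/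
theorem lam_vanishes_of_xm_lt_y1
    (q : ℝ) (hq : q ∈ Set.Ioo (0 : ℝ) 1) (a b : ℤ → ℝ)
    (ha : ∀ i, 0 < a i) (hb : ∀ i, b i = a i * (1 - q))
    (n : ℕ) (X Y : Fin (n + 1) → ℤ) (hX : Antitone X) (hY : Antitone Y)
    (m : Fin (n + 1)) (σ : Equiv.Perm (Fin (n + 1))) (hσ : σ m = 0)
    (h : X m < Y 0) (R : ℝ) (hR : ValidR b X Y R) :
    Lam q b Y X 0 σ R = 0 := by
  have hb0 : ∀ k, 0 < b k := fun k => by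
    rw [hb]
    exact mul_pos (ha k) (sub_pos.2 hq.2)
  have hR0 : 0 < R := (hb0 (X 0)).trans
    (hR _ ⟨0, by linarith [min_le_left (X 0) (Y 0)]⟩ ⟨0, le_max_left _ _⟩)
  unfold Lam
  simp only [Complex.ofReal_zero, mul_zero, Complex.exp_zero, mul_one]
  rw [mcInt_eq_zero_of_differentiableAt hR0.le, mul_zero]
  · refine (continuous_Acoef_torus hq hR0 σ).mul (continuous_finsetProd _ fun j _ => ?_)
    exact (continuous_eprod_circleMap hR0 hb0 fun k hk hk' =>
      hR k ⟨σ j, by linarith [min_le_right (X (σ j)) (Y (σ j))]⟩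
        ⟨j, hk'.trans (le_max_left _ _)⟩).comp (continuous_apply (σ j))
  · intro w hw z hz
    refine (differentiableAt_Acoef_cons hq hR0 σ hw hz).fun_mul
      (DifferentiableAt.fun_finsetProd fun j _ => ?_)
    by_cases hj : j = m
    · subst hj
      simpa only [hσ, Fin.cons_zero] using differentiable_eprod_of_lt b h z
    · obtain ⟨i, hi⟩ := Fin.exists_succ_eq.2
        (fun h0 : σ j = 0 => hj (σ.injective (h0.trans hσ.symm)))
      simp [← hi]
end
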